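/- Let u : ℝ² → ℝ be smooth and solve the KdV equation, let λ₁, …, λ_n ∈ ℝ, and let θ₁, …, θ_n : ℝ² → ℝ be smooth solutions of the associated linear system at λ₁, …, λ_n respectively, such that the Wronskian W := det(∂ₓ^{i−1}θ_j)_{1≤i,j≤n} is nowhere vanishing. Then û := u + 2∂ₓ(∂ₓW/W) also solves the KdV equation. -/

import Mathlib

noncomputable section

/-- The partial derivative in `x` of a function of `(x,t)`. -/
def pdxR (u : ℝ → ℝ → ℝ) : ℝ → ℝ → ℝ := fun x t => deriv (fun y => u y t) x

/-- The partial derivative in `t` of a function of `(x,t)`. -/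
def pdtR (u : ℝ → ℝ → ℝ) : ℝ → ℝ → ℝ := fun x t => deriv (fun s => u x s) t

/-- The KdV equation `∂ₜu = (1/4)(∂ₓ³u + 6u∂ₓu)`. -/
def KdVR (u : ℝ → ℝ → ℝ) : Prop :=
  ∀ x t, pdtR u x t = (1/4) * (pdxR (pdxR (pdxR u)) x t + 6 * u x t * pdxR u x t)

/-- The linear system associated with `u` at `λ`:
`∂ₓ²θ + uθ = λθ` and `∂ₜθ = λ∂ₓθ + (1/2)u∂ₓθ − (1/4)(∂ₓu)θ`. -/
def KdVLin (u θ : ℝ → ℝ → ℝ) (lam : ℝ) : Prop :=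
  (∀ x t, pdxR (pdxR θ) x t + u x t * θ x t = lam * θ x t) ∧
  (∀ x t, pdtR θ x t = lam * pdxR θ x t + (1/2) * (u x t * pdxR θ x t)
      - (1/4) * (pdxR u x t * θ x t))

section alg
variable {R : Type*} [CommRing R]

def aK (d e : Derivation ℤ R R) (u : R) : Prop :=
  4 * e u = d (d (d u)) + 6 * u * d u

def aL (d e : Derivation ℤ R R) (u θ l : R) : Prop :=
  d (d θ) + u * θ = l * θ ∧ 4 * e θ = 4 * l * d θ + 2 * u * d θ - d u * θ

lemma d_two (d : Derivation ℤ R R) : d 2 = 0 := by exact_mod_cast d.map_natCast 2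
lemma d_four (d : Derivation ℤ R R) : d 4 = 0 := by exact_mod_cast d.map_natCast 4
lemma d_six (d : Derivation ℤ R R) : d 6 = 0 := by exact_mod_cast d.map_natCast 6

lemma riccati (d e : Derivation ℤ R R) (hde : ∀ a, d (e a) = e (d a)) (u θ l v : R)
    (hθ : IsUnit θ) (hl : d l = 0) (h : aL d e u θ l) (hv : v * θ = d θ) :
    d v = l - v ^ 2 - u ∧ 4 * e v = 4 * l * d v + 2 * d u * v + 2 * u * d v - d (d u) := by
  obtain ⟨h1, h2⟩ := h
  have h3 := congrArg d hv
  have h4 := congrArg e hv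
  have h5 := congrArg d h2
  have h6 := hde θ
  have h7 := congrArg d h3
  simp only [Derivation.leibniz, map_add, map_sub, smul_eq_mul, d_two, d_four, hl] at h3 h4 h5 h7
  constructor
  · apply hθ.mul_right_cancel
    linear_combination h3 + h1 + v * hv
  · apply hθ.mul_right_cancel
    linear_combination 4 * h4 - v * h2 + h5 - 4 * h6 - (4 * l + 2 * u) * h3 + (- d u) * hv

lemma darboux (d e : Derivation ℤ R R) (hde : ∀ a, d (e a) = e (d a)) (u l v : R)
    (hl : d l = 0) (hK : aK d e u) (h1 : d v = l - v ^ 2 - u)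
    (h2 : 4 * e v = 4 * l * d v + 2 * d u * v + 2 * u * d v - d (d u)) :
    aK d e (u + 2 * d v) := by
  unfold aK at *
  have h3 := congrArg d h2
  have h4 := congrArg d h1
  have h5 := congrArg d h4
  have h6 := congrArg d h5
  have h7 := hde v
  simp only [Derivation.leibniz, map_add, map_sub, pow_two, smul_eq_mul, d_two, d_four, hl, map_zero] at h3 h4 h5 h6 ⊢
  rw [h7] at h3
  generalize e (d v) = z at *
  rw [h6, h5, h4, h1]
  rw [h4, h1] at h3
  linear_combination hK + 2 * h3

lemma darboux_lin (d e : Derivation ℤ R R) (hde : ∀ a, d (e a) = e (d a)) (u l v φ m : R)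
    (hl : d l = 0) (hm : d m = 0) (h1 : d v = l - v ^ 2 - u)
    (h2 : 4 * e v = 4 * l * d v + 2 * d u * v + 2 * u * d v - d (d u)) (h : aL d e u φ m) :
    aL d e (u + 2 * d v) (d φ - v * φ) m := by
  obtain ⟨g1, g2⟩ := h
  have g1 : d (d φ) = m * φ - u * φ := by linear_combination g1
  have h4 := congrArg d h1
  have g3 := congrArg d g1
  have g4 := congrArg d g2
  have h7 := hde φ
  simp only [Derivation.leibniz, map_add, map_sub, pow_two, smul_eq_mul, d_two, d_four, hl, hm] at h4 g3 g4
  simp only [aL]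
  simp only [Derivation.leibniz, map_add, map_sub, pow_two, smul_eq_mul, d_two, d_four, hl, hm]
  rw [h7] at g4
  generalize e (d φ) = z at *
  rw [g3, h4, h1, g1]
  rw [h1] at h2
  rw [g1] at g4
  constructor
  · ring
  · linear_combination g4 - φ * h2 - v * g2

lemma iter_expand (d : Derivation ℤ R R) (v : R) (i : ℕ) : ∃ c : ℕ → R, ∀ φ,
    d^[i] (d φ - v * φ) = d^[i+1] φ + ∑ k ∈ Finset.range (i+1), c k * d^[k] φ := by
  induction i with
  | zero => exact ⟨fun _ => -v, fun φ => by simp; ring⟩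
  | succ i ih =>
    obtain ⟨c, hc⟩ := ih
    refine ⟨fun k => (if k < i + 1 then d (c k) else 0) + (if k = 0 then 0 else c (k-1)), fun φ => ?_⟩
    rw [Function.iterate_succ_apply', hc, map_add, map_sum]
    simp only [Derivation.leibniz, smul_eq_mul, add_mul, Finset.sum_add_distrib,
      ← Function.iterate_succ_apply' (⇑d)]
    rw [Finset.sum_range_succ _ (i+1), Finset.sum_range_succ' (n := i+1)
      (f := fun x => (if x = 0 then 0 else c (x-1)) * d^[x] φ)]
    have : ∀ x ∈ Finset.range (i+1), (if x < i+1 then d (c x) else 0) * d^[x] φ = d^[x] φ * d (c x) := by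
      intro x hx
      rw [if_pos (Finset.mem_range.1 hx)]; ring
    rw [Finset.sum_congr rfl this]
    simp
    ring

def wr (d : Derivation ℤ R R) {n : ℕ} (θ : Fin n → R) : R :=
  Matrix.det (Matrix.of fun i j : Fin n => d^[i.1] (θ j))

lemma wr_succ (d : Derivation ℤ R R) {n : ℕ} (θ : Fin (n+1) → R) (v : R) (hv : v * θ 0 = d (θ 0)) :
    wr d θ = θ 0 * wr d (fun j : Fin n => d (θ j.succ) - v * θ j.succ) := by
  choose c hc using iter_expand d v
  let T : Matrix (Fin (n+1)) (Fin (n+1)) R := Matrix.of fun i k =>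
    if k = i then 1 else if k < i then c (i.1-1) k.1 else 0
  have hT : T.det = 1 := by
    rw [Matrix.det_of_isLowerTriangular]
    · simp [T]
    · intro i j hij
      have : i < j := hij
      simp [T, this.ne', this.not_gt]
  have hM : ∀ (i : Fin n) (j : Fin (n+1)), (T * (Matrix.of fun i j : Fin (n+1) => d^[i.1] (θ j))) i.succ j
      = d^[i.1] (d (θ j) - v * θ j) := by
    intro i j
    rw [hc, Matrix.mul_apply]
    have hi : i.1 + 1 ≤ n := i.2
    have e1 : ∀ k : Fin (n+1), T i.succ k * (Matrix.of fun i j : Fin (n+1) => d^[i.1] (θ j)) k j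
      = (fun k : ℕ => (if k = i.1+1 then 1 else if k < i.1+1 then c i.1 k else 0) * d^[k] (θ j)) k.1 := by
      intro k
      simp only [T, Fin.ext_iff, Fin.lt_def, Matrix.of_apply, Fin.val_succ, Nat.add_sub_cancel]
    rw [Finset.sum_congr rfl (fun k _ => e1 k), Fin.sum_univ_eq_sum_range (fun k : ℕ => (if k = i.1+1 then 1 else if k < i.1+1 then c i.1 k else 0) * d^[k] (θ j))]
    rw [← Finset.sum_subset (s₁ := Finset.range (i.1+2))]
    · rw [Finset.sum_range_succ, add_comm]
      congr 1
      · simp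
      · refine Finset.sum_congr rfl fun x hx => ?_
        have := Finset.mem_range.1 hx
        rw [if_neg this.ne, if_pos this]
    · intro x hx; simp at *; omega
    · intro x _ hx
      simp at hx
      rw [if_neg (by omega), if_neg (by omega), zero_mul]
  have h0 : ∀ j, (T * (Matrix.of fun i j : Fin (n+1) => d^[i.1] (θ j))) 0 j = θ j := by
    intro j
    rw [Matrix.mul_apply, Fin.sum_univ_succ]
    simp [T, Fin.succ_ne_zero]
  have hz : ∀ i : ℕ, d^[i] 0 = 0 := fun i => Function.iterate_fixed (map_zero d) i
  unfold wr
  rw [← one_mul (Matrix.det _), ← hT, ← Matrix.det_mul, Matrix.det_succ_column_zero, Fin.sum_univ_succ]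
  rw [Finset.sum_eq_zero]
  · simp only [h0]
    simp only [Fin.val_zero, pow_zero, one_mul, add_zero]
    congr 2
    ext i j
    simp only [Matrix.submatrix_apply, Fin.succAbove_zero, hM, Matrix.of_apply]
  · intro i _
    rw [hM, hv, sub_self, hz]; simp

theorem crum_alg [IsLocalRing R] (d e : Derivation ℤ R R) (hde : ∀ a, d (e a) = e (d a)) (n : ℕ) :
    ∀ (u : R) (l θ : Fin n → R) (_ : ∀ j, d (l j) = 0) (_ : aK d e u) (_ : ∀ j, aL d e u (θ j) (l j))
    (_ : IsUnit (wr d θ)) (y : R) (_ : y * wr d θ = d (wr d θ)), aK d e (u + 2 * d y) := by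
  induction n with
  | zero =>
    intro u l θ hl hK hL hW y hy
    have : wr d θ = 1 := by simp [wr]
    rw [this] at hy
    have : y = 0 := by simpa using hy
    simpa [this] using hK
  | succ n ih =>
    -- first the case where the first entry is a unit
    have key : ∀ (u : R) (l θ : Fin (n+1) → R) (_ : IsUnit (θ 0)) (_ : ∀ j, d (l j) = 0) (_ : aK d e u) (_ : ∀ j, aL d e u (θ j) (l j))
        (_ : IsUnit (wr d θ)) (y : R) (_ : y * wr d θ = d (wr d θ)), aK d e (u + 2 * d y) := by
      intro u l θ h0 hl hK hL hW y hy
      obtain ⟨v, hv⟩ : ∃ v, v * θ 0 = d (θ 0) := by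
        obtain ⟨w, hw⟩ := h0.exists_left_inv
        exact ⟨d (θ 0) * w, by rw [mul_assoc, hw, mul_one]⟩
      obtain ⟨r1, r2⟩ := riccati d e hde u (θ 0) (l 0) v h0 (hl 0) (hL 0) hv
      have hw := wr_succ d θ v hv
      set ψ : Fin n → R := fun j => d (θ j.succ) - v * θ j.succ with hψ
      have hu2 : IsUnit (wr d ψ) := isUnit_of_mul_isUnit_right (hw ▸ hW)
      have hfin := ih (u + 2 * d v) (fun j => l j.succ) ψ (fun j => hl _)
        (darboux d e hde u (l 0) v (hl 0) hK r1 r2)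
        (fun j => darboux_lin d e hde u (l 0) v _ _ (hl 0) (hl _) r1 r2 (hL _)) hu2 (y - v) (by
          apply h0.mul_left_cancel
          rw [hw] at hy
          simp only [Derivation.leibniz, smul_eq_mul] at hy
          linear_combination hy - wr d ψ * hv)
      have e1 : u + 2 * d v + 2 * d (y - v) = u + 2 * d y := by rw [map_sub]; ring
      rwa [e1] at hfin
    intro u l θ hl hK hL hW y hy
    obtain ⟨j, hj⟩ : ∃ j, IsUnit (θ j) := by
      by_contra! hc
      have : wr d θ ∈ IsLocalRing.maximalIdeal R := by
        unfold wr
        rw [Matrix.det_succ_row_zero]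
        refine Ideal.sum_mem _ fun j _ => ?_
        refine Ideal.mul_mem_right _ _ (Ideal.mul_mem_left _ _ ?_)
        simpa using hc j
      exact (IsLocalRing.mem_maximalIdeal _).1 this hW
    let σ := Equiv.swap 0 j
    have hs : wr d (θ ∘ σ) = (Equiv.Perm.sign σ : ℤ) * wr d θ := by
      unfold wr
      rw [← Matrix.det_permute']
      rfl
    have hsu : ((Equiv.Perm.sign σ : ℤ) : R) = 1 ∨ ((Equiv.Perm.sign σ : ℤ) : R) = -1 := by
      rcases Int.units_eq_one_or (Equiv.Perm.sign σ) with h | h <;> simp [h]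
    refine key u (l ∘ σ) (θ ∘ σ) (by simpa [σ] using hj) (fun j => hl _) hK (fun j => hL _) ?_ y ?_
    · rw [hs]
      rcases hsu with h | h <;> simpa [h] using hW
    · rw [hs]
      rcases hsu with h | h <;> simp [h, hy]
end alg

section germs
open Filter Topology

def SG (p : ℝ × ℝ) : Subring (Germ (𝓝 p) ℝ) where
  carrier := {g | ∃ f : ℝ × ℝ → ℝ, ContDiffAt ℝ (⊤ : ℕ∞) f p ∧ (f : Germ (𝓝 p) ℝ) = g}
  mul_mem' := by
    rintro _ _ ⟨f, hf, rfl⟩ ⟨g, hg, rfl⟩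
    exact ⟨f * g, hf.mul hg, rfl⟩
  one_mem' := ⟨1, contDiffAt_const, rfl⟩
  add_mem' := by
    rintro _ _ ⟨f, hf, rfl⟩ ⟨g, hg, rfl⟩
    exact ⟨f + g, hf.add hg, rfl⟩
  zero_mem' := ⟨0, contDiffAt_const, rfl⟩
  neg_mem' := by
    rintro _ ⟨f, hf, rfl⟩
    exact ⟨-f, hf.neg, rfl⟩

def mkS {p : ℝ × ℝ} (f : ℝ × ℝ → ℝ) (hf : ContDiffAt ℝ (⊤ : ℕ∞) f p) : SG p := ⟨(f : Germ (𝓝 p) ℝ), f, hf, rfl⟩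

lemma mkS_surj {p : ℝ × ℝ} (a : SG p) : ∃ f hf, a = mkS f hf := by
  obtain ⟨_, f, hf, rfl⟩ := a
  exact ⟨f, hf, rfl⟩

lemma mkS_eq {p : ℝ × ℝ} {f g : ℝ × ℝ → ℝ} {hf : ContDiffAt ℝ (⊤ : ℕ∞) f p} {hg : ContDiffAt ℝ (⊤ : ℕ∞) g p} :
    mkS f hf = mkS g hg ↔ f =ᶠ[𝓝 p] g := by
  exact Subtype.ext_iff.trans Germ.coe_eq

lemma smooth_dw {p : ℝ × ℝ} {f : ℝ × ℝ → ℝ} (hf : ContDiffAt ℝ (⊤ : ℕ∞) f p) (w : ℝ × ℝ) :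
    ContDiffAt ℝ (⊤ : ℕ∞) (fun q => fderiv ℝ f q w) p :=
  (hf.fderiv_right (m := ((⊤ : ℕ∞) : WithTop ℕ∞)) (by norm_cast)).clm_apply contDiffAt_const

lemma ev_diff {p : ℝ × ℝ} {f : ℝ × ℝ → ℝ} (hf : ContDiffAt ℝ (⊤ : ℕ∞) f p) :
    ∀ᶠ q in 𝓝 p, DifferentiableAt ℝ f q := by
  have : ContDiffAt ℝ 1 f p := hf.of_le (by exact_mod_cast le_top)
  filter_upwards [this.eventually (by simp)] with q hq
  exact hq.differentiableAt (by simp)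

lemma ev_c2 {p : ℝ × ℝ} {f : ℝ × ℝ → ℝ} (hf : ContDiffAt ℝ (⊤ : ℕ∞) f p) :
    ∀ᶠ q in 𝓝 p, ContDiffAt ℝ 2 f q := by
  have : ContDiffAt ℝ 2 f p := hf.of_le (WithTop.coe_le_coe.2 (le_top : (2 : ℕ∞) ≤ ⊤))
  exact this.eventually (by simp)

def dg {p : ℝ × ℝ} (w : ℝ × ℝ) : Germ (𝓝 p) ℝ → Germ (𝓝 p) ℝ :=
  Germ.map' (fun f q => fderiv ℝ f q w) (by
    intro f g h
    filter_upwards [h.fderiv (𝕜 := ℝ)] with q hq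
    rw [hq])

def dS {p : ℝ × ℝ} (w : ℝ × ℝ) (a : SG p) : SG p := ⟨dg w a.1, by
  obtain ⟨_, f, hf, rfl⟩ := a
  exact ⟨_, smooth_dw hf w, rfl⟩⟩

lemma dS_mk {p : ℝ × ℝ} (w : ℝ × ℝ) (f : ℝ × ℝ → ℝ) (hf : ContDiffAt ℝ (⊤ : ℕ∞) f p) :
    dS w (mkS f hf) = mkS (fun q => fderiv ℝ f q w) (smooth_dw hf w) := rfl

def DS {p : ℝ × ℝ} (w : ℝ × ℝ) : Derivation ℤ (SG p) (SG p) :=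
  Derivation.mk' (AddMonoidHom.toIntLinearMap (AddMonoidHom.mk' (dS w) (by
    intro a b
    obtain ⟨f, hf, rfl⟩ := mkS_surj a
    obtain ⟨g, hg, rfl⟩ := mkS_surj b
    have e1 : mkS f hf + mkS g hg = mkS (f + g) (hf.add hg) := rfl
    have e2 : ∀ f g (hf : ContDiffAt ℝ (⊤ : ℕ∞) f p) (hg : ContDiffAt ℝ (⊤ : ℕ∞) g p), mkS f hf + mkS g hg = mkS (f + g) (hf.add hg) := fun _ _ _ _ => rfl
    rw [e1, dS_mk, dS_mk, dS_mk, e2, mkS_eq]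
    filter_upwards [ev_diff hf, ev_diff hg] with q h1 h2
    rw [fderiv_add h1 h2]; rfl))) (by
    intro a b
    obtain ⟨f, hf, rfl⟩ := mkS_surj a
    obtain ⟨g, hg, rfl⟩ := mkS_surj b
    change dS w (mkS f hf * mkS g hg) = mkS f hf * dS w (mkS g hg) + mkS g hg * dS w (mkS f hf)
    have e1 : mkS f hf * mkS g hg = mkS (f * g) (hf.mul hg) := rfl
    rw [e1, dS_mk, dS_mk, dS_mk]
    change _ = mkS (f * (fun q => fderiv ℝ g q w) + g * (fun q => fderiv ℝ f q w)) ((hf.mul (smooth_dw hg w)).add (hg.mul (smooth_dw hf w)))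
    rw [mkS_eq]
    filter_upwards [ev_diff hf, ev_diff hg] with q h1 h2
    rw [fderiv_mul h1 h2]; rfl)

lemma DS_mk {p : ℝ × ℝ} (w : ℝ × ℝ) (f : ℝ × ℝ → ℝ) (hf : ContDiffAt ℝ (⊤ : ℕ∞) f p) :
    DS w (mkS f hf) = mkS (fun q => fderiv ℝ f q w) (smooth_dw hf w) := rfl

lemma DS_comm {p : ℝ × ℝ} (w z : ℝ × ℝ) (a : SG p) : DS w (DS z a) = DS z (DS w a) := by
  obtain ⟨f, hf, rfl⟩ := mkS_surj a
  rw [DS_mk, DS_mk, DS_mk, DS_mk, mkS_eq]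
  filter_upwards [ev_c2 hf] with q hq
  have hd : DifferentiableAt ℝ (fderiv ℝ f) q :=
    (hq.fderiv_right (m := 1) (by norm_num)).differentiableAt (by simp)
  have key : ∀ v : ℝ × ℝ, fderiv ℝ (fun q => fderiv ℝ f q v) q = (fderiv ℝ (fderiv ℝ f) q).flip v := by
    intro v
    rw [fderiv_clm_apply hd (by fun_prop)]
    ext <;> simp
  rw [key, key]
  exact (hq.isSymmSndFDerivAt (by simp)) w z

def evS (p : ℝ × ℝ) : SG p →+* ℝ := Germ.valueRingHom.comp (SG p).subtype

lemma evS_mk {p : ℝ × ℝ} (f : ℝ × ℝ → ℝ) (hf : ContDiffAt ℝ (⊤ : ℕ∞) f p) : evS p (mkS f hf) = f p := rfl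

lemma isUnit_mkS {p : ℝ × ℝ} (f : ℝ × ℝ → ℝ) (hf : ContDiffAt ℝ (⊤ : ℕ∞) f p) (h : f p ≠ 0) : IsUnit (mkS f hf) := by
  apply IsUnit.of_mul_eq_one (mkS (fun q => (f q)⁻¹) (hf.inv h))
  change mkS (f * fun q => (f q)⁻¹) (hf.mul (hf.inv h)) = mkS 1 contDiffAt_const
  rw [mkS_eq]
  filter_upwards [hf.continuousAt.eventually_ne h] with q hq
  simp [hq]

instance {p : ℝ × ℝ} : IsLocalHom (evS p) := ⟨by
  intro a ha
  obtain ⟨f, hf, rfl⟩ := mkS_surj a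
  exact isUnit_mkS f hf ha.ne_zero⟩

instance {p : ℝ × ℝ} : IsLocalRing (SG p) := RingHom.domain_isLocalRing (evS p)

abbrev Sm (f : ℝ → ℝ → ℝ) : Prop := ContDiff ℝ (⊤ : ℕ∞) (fun p : ℝ × ℝ => f p.1 p.2)

lemma Sm.diff {f : ℝ → ℝ → ℝ} (hf : Sm f) : Differentiable ℝ (fun p : ℝ × ℝ => f p.1 p.2) :=
  hf.differentiable (by simp)

lemma pdx_eq {f : ℝ → ℝ → ℝ} (hf : Sm f) (x t : ℝ) :
    pdxR f x t = fderiv ℝ (fun p : ℝ × ℝ => f p.1 p.2) (x, t) (1, 0) := by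
  have h1 := (hf.diff (x, t)).hasFDerivAt
  have h2 : HasDerivAt (fun y : ℝ => (y, t)) ((1 : ℝ), (0 : ℝ)) x := (hasDerivAt_id x).prodMk (hasDerivAt_const x t)
  exact (h1.comp_hasDerivAt x h2).deriv

lemma pdt_eq {f : ℝ → ℝ → ℝ} (hf : Sm f) (x t : ℝ) :
    pdtR f x t = fderiv ℝ (fun p : ℝ × ℝ => f p.1 p.2) (x, t) (0, 1) := by
  have h1 := (hf.diff (x, t)).hasFDerivAt
  have h2 : HasDerivAt (fun y : ℝ => (x, y)) ((0 : ℝ), (1 : ℝ)) t := (hasDerivAt_const t x).prodMk (hasDerivAt_id t)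
  exact (h1.comp_hasDerivAt t h2).deriv

lemma Sm.pdx {f : ℝ → ℝ → ℝ} (hf : Sm f) : Sm (pdxR f) := by
  unfold Sm
  simp only [pdx_eq hf]
  exact (hf.fderiv_right (m := ((⊤ : ℕ∞) : WithTop ℕ∞)) (by norm_cast)).clm_apply contDiff_const

lemma Sm.pdt {f : ℝ → ℝ → ℝ} (hf : Sm f) : Sm (pdtR f) := by
  unfold Sm
  simp only [pdt_eq hf]
  exact (hf.fderiv_right (m := ((⊤ : ℕ∞) : WithTop ℕ∞)) (by norm_cast)).clm_apply contDiff_const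

lemma Sm.iter {f : ℝ → ℝ → ℝ} (hf : Sm f) (i : ℕ) : Sm (pdxR^[i] f) := by
  induction i with
  | zero => exact hf
  | succ i ih => rw [Function.iterate_succ_apply']; exact ih.pdx

/-- germ at `p` of a smooth function -/
def cl (p : ℝ × ℝ) (f : ℝ → ℝ → ℝ) (hf : Sm f) : SG p := mkS (fun q => f q.1 q.2) hf.contDiffAt

lemma cl_congr (p : ℝ × ℝ) {f g : ℝ → ℝ → ℝ} (hf : Sm f) (hg : Sm g) (h : ∀ x t, f x t = g x t) :
    cl p f hf = cl p g hg := by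
  have : f = g := by ext; exact h _ _
  subst this; rfl

lemma cl_dx (p : ℝ × ℝ) {f : ℝ → ℝ → ℝ} (hf : Sm f) : DS (1, 0) (cl p f hf) = cl p (pdxR f) hf.pdx := by
  unfold cl
  rw [DS_mk, mkS_eq]
  exact .of_forall fun q => (pdx_eq hf q.1 q.2).symm

lemma cl_dt (p : ℝ × ℝ) {f : ℝ → ℝ → ℝ} (hf : Sm f) : DS (0, 1) (cl p f hf) = cl p (pdtR f) hf.pdt := by
  unfold cl
  rw [DS_mk, mkS_eq]
  exact .of_forall fun q => (pdt_eq hf q.1 q.2).symm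

lemma cl_iter (p : ℝ × ℝ) {f : ℝ → ℝ → ℝ} (hf : Sm f) (i : ℕ) :
    (DS (1, 0))^[i] (cl p f hf) = cl p (pdxR^[i] f) (hf.iter i) := by
  induction i with
  | zero => rfl
  | succ i ih =>
    rw [Function.iterate_succ_apply', ih, cl_dx]
    apply cl_congr
    intro x t
    rw [Function.iterate_succ_apply']

lemma evS_cl (p : ℝ × ℝ) {f : ℝ → ℝ → ℝ} (hf : Sm f) : evS p (cl p f hf) = f p.1 p.2 := rfl

/-- equalities of germs can be checked as functions -/
lemma coe_cl (p : ℝ × ℝ) {f : ℝ → ℝ → ℝ} (hf : Sm f) :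
    ((cl p f hf : SG p) : Germ (𝓝 p) ℝ) = Germ.coeRingHom (𝓝 p) (fun q : ℝ × ℝ => f q.1 q.2) := rfl

lemma cl_wr (p : ℝ × ℝ) {n : ℕ} {θ : Fin n → ℝ → ℝ → ℝ} (hθ : ∀ j, Sm (θ j)) (W : ℝ → ℝ → ℝ)
    (hW : W = fun x t => Matrix.det (Matrix.of fun i j : Fin n => (pdxR^[i.1] (θ j)) x t)) (hWs : Sm W) :
    wr (DS (1, 0)) (fun j => cl p (θ j) (hθ j)) = cl p W hWs := by
  unfold wr
  apply Subtype.ext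
  rw [coe_cl]
  simp only [cl_iter]
  change (SG p).subtype _ = _
  rw [RingHom.map_det]
  have e1 : (fun q : ℝ × ℝ => W q.1 q.2) = Matrix.det (Matrix.of fun (i j : Fin n) (q : ℝ × ℝ) => (pdxR^[i.1] (θ j)) q.1 q.2) := by
    funext q
    have := RingHom.map_det (Pi.evalRingHom (fun _ : ℝ × ℝ => ℝ) q) (Matrix.of fun (i j : Fin n) (q : ℝ × ℝ) => (pdxR^[i.1] (θ j)) q.1 q.2)
    rw [hW]
    exact this.symm
  rw [e1, RingHom.map_det]
  rfl

end germs

/-- the Crum transformation for KdV: if `W` is the Wronskian of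
solutions `θ₁,…,θ_n` of the linear systems, then `û = u + 2∂ₓ(∂ₓW/W)` solves KdV. -/
theorem statement_15 (n : ℕ) (u : ℝ → ℝ → ℝ) (lam : Fin n → ℝ)
    (θ : Fin n → ℝ → ℝ → ℝ)
    (hu : ContDiff ℝ (⊤ : ℕ∞) (fun p : ℝ × ℝ => u p.1 p.2))
    (hθ : ∀ j, ContDiff ℝ (⊤ : ℕ∞) (fun p : ℝ × ℝ => θ j p.1 p.2))
    (hK : KdVR u) (hL : ∀ j, KdVLin u (θ j) (lam j))
    (W : ℝ → ℝ → ℝ)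
    (hW : W = fun x t => Matrix.det (Matrix.of fun i j : Fin n => (pdxR^[i.1] (θ j)) x t))
    (hW0 : ∀ x t, W x t ≠ 0) :
    KdVR (fun x t => u x t + 2 * pdxR (fun y s => pdxR W y s / W y s) x t) := by
  have hWs : Sm W := by
    rw [hW]
    simp only [Sm, Matrix.det_apply, Matrix.of_apply]
    refine ContDiff.sum fun σ _ => ?_
    refine ContDiff.const_smul _ ?_
    exact contDiff_prod fun i _ => Sm.iter (hθ i) _
  have hys : Sm (fun y s => pdxR W y s / W y s) := hWs.pdx.div hWs fun p => hW0 _ _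
  have hnew : Sm (fun x t => u x t + 2 * pdxR (fun y s => pdxR W y s / W y s) x t) :=
    ContDiff.add hu (contDiff_const.mul hys.pdx)
  intro x t
  set p : ℝ × ℝ := (x, t) with hp
  have hc : ∀ c : ℝ, Sm (fun _ _ => c) := fun c => contDiff_const
  have key := crum_alg (DS (p := p) (1, 0)) (DS (0, 1)) (fun a => DS_comm _ _ a) n (cl p u hu)
    (fun j => cl p (fun _ _ => lam j) (hc _)) (fun j => cl p (θ j) (hθ j))
    (by
      intro j
      rw [cl_dx]
      exact cl_congr p (hc _).pdx (hc 0) fun x t => by simp [pdxR])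
    (by
      unfold aK
      simp only [cl_dx, cl_dt]
      refine cl_congr p (f := fun x t => 4 * pdtR u x t)
        (g := fun x t => pdxR (pdxR (pdxR u)) x t + 6 * u x t * pdxR u x t)
        (contDiff_const.mul (Sm.pdt hu))
        ((Sm.pdx hu).pdx.pdx.add ((contDiff_const.mul hu).mul (Sm.pdx hu))) fun x t => ?_
      rw [hK]; ring)
    (by
      intro j
      have h : Sm (θ j) := hθ j
      obtain ⟨h1, h2⟩ := hL j
      unfold aL
      simp only [cl_dx, cl_dt]
      constructor
      · exact cl_congr p (f := fun x t => pdxR (pdxR (θ j)) x t + u x t * θ j x t)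
          (g := fun x t => lam j * θ j x t)
          (h.pdx.pdx.add (hu.mul h)) (contDiff_const.mul h) h1
      · refine cl_congr p (f := fun x t => 4 * pdtR (θ j) x t)
          (g := fun x t => 4 * lam j * pdxR (θ j) x t + 2 * u x t * pdxR (θ j) x t - pdxR u x t * θ j x t)
          (contDiff_const.mul h.pdt)
          (((contDiff_const.mul h.pdx).add ((contDiff_const.mul hu).mul h.pdx)).sub ((Sm.pdx hu).mul h)) fun x t => ?_
        rw [h2]; ring)
    (by
      rw [cl_wr p hθ W hW hWs]
      exact isUnit_mkS _ _ (hW0 _ _))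
    (cl p _ hys)
    (by
      rw [cl_wr p hθ W hW hWs, cl_dx]
      exact cl_congr p (f := fun x t => pdxR W x t / W x t * W x t) (hys.mul hWs) hWs.pdx
        fun x t => div_mul_cancel₀ _ (hW0 x t))
  have e1 : cl p u hu + 2 * DS (1, 0) (cl p _ hys) = cl p _ hnew := by
    rw [cl_dx]; rfl
  rw [e1] at key
  unfold aK at key
  simp only [cl_dx, cl_dt] at key
  have k2 := congrArg (evS p) key
  simp only [map_mul, map_add, map_ofNat] at k2
  simp only [evS_cl] at k2
  simp only [hp] at k2
  linarith
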